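/- arXiv:2309.05611 — 3 statements merged into one kernel-verified Lean document; each statement's English description precedes it below -/
import Mathlib

section
/- Let k ≥ 2 and m₁,…,m_k ≥ 4. The orbit space (S^{m₁} × S^{m₂} × ⋯ × S^{m_k})/Sp(1)^{k−1} of the product of spheres by the described action of the quaternionic torus Sp(1)^{k−1} is homeomorphic to the sphere S^m, where m = m₁ + ⋯ + m_k − 3(k−1). -/
open scoped BigOperators

noncomputable section

/-- Helper for the chain action of `G^{k-1}` on a `k`-fold product: `chainExt k r j` is
`r_{j}` (1-indexed, i.e. `r ⟨j-1⟩`) for `1 ≤ j ≤ k-1` and `1` otherwise, so that the `i`-th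
component (0-indexed) of the action is `q_i ↦ chainExt k r i * q_i * (chainExt k r (i+1))⁻¹`,
realizing `(q₁r₁⁻¹, r₁q₂r₂⁻¹, …, r_{k-1}q_k)`. -/
def chainExt (k : ℕ) {G : Type*} [One G] (r : Fin (k - 1) → G) (j : ℕ) : G :=
  if h : 1 ≤ j ∧ j ≤ k - 1 then r ⟨j - 1, by omega⟩ else 1

/-- The orbit relation of the quaternionic torus `Sp(1)^{k-1}` acting on the product of the
spheres `S^{m i} = {(x, q) ∈ ℝ^{m i - 3} × ℍ : |x|² + |q|² = 1}` by
`(r₁,…,r_{k-1})·((x₁,q₁),…,(x_k,q_k)) = ((x₁, q₁r₁⁻¹), (x₂, r₁q₂r₂⁻¹), …, (x_k, r_{k-1}q_k))`. -/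
def spRel (k : ℕ) (m : Fin k → ℕ)
    (a b : ∀ i : Fin k,
      {p : EuclideanSpace ℝ (Fin (m i - 3)) × Quaternion ℝ // ‖p.1‖ ^ 2 + ‖p.2‖ ^ 2 = 1}) :
    Prop :=
  ∃ r : Fin (k - 1) → Quaternion ℝ, (∀ j, ‖r j‖ = 1) ∧
    ∀ i : Fin k, (b i).1.1 = (a i).1.1 ∧
      (b i).1.2 = chainExt k r (i : ℕ) * (a i).1.2 * (chainExt k r ((i : ℕ) + 1))⁻¹

open scoped Quaternion

lemma norm_list_ofFn_prod {D : Type*} [NormedDivisionRing D] {n : ℕ} (a : Fin n → D) :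
    ‖(List.ofFn a).prod‖ = ∏ i, ‖a i‖ := by
  have h := map_list_prod (normHom : D →*₀ ℝ) (List.ofFn a)
  rw [List.map_ofFn, List.prod_ofFn] at h
  exact h

/-- A product telescopes under a chain of gauge transformations. -/
lemma mul_prod_ofFn_eq_prod_ofFn_mul {M : Type*} [Monoid M] {n : ℕ} (a b : Fin n → M)
    (e : ℕ → M) (h : ∀ i : Fin n, b i * e (i + 1) = e i * a i) :
    e 0 * (List.ofFn a).prod = (List.ofFn b).prod * e n := by
  induction n generalizing e with
  | zero => simp
  | succ n ih =>
    have h0 := h 0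
    have hs := ih (fun i => a i.succ) (fun i => b i.succ) (fun j => e (j + 1))
      (fun i => by simpa using h i.succ)
    simp only [Fin.val_zero, zero_add] at h0 hs
    rw [List.ofFn_succ, List.ofFn_succ, List.prod_cons, List.prod_cons, ← mul_assoc, ← h0,
      mul_assoc, hs, mul_assoc]

/-- Two tuples with the same norms whose products differ by unit factors at both ends are related
by a chain of unit gauge transformations with these factors at the ends. -/
lemma exists_chain_of_mul_prod_eq {D : Type*} [NormedDivisionRing D] {n : ℕ} (a b : Fin n → D)
    (hab : ∀ i, ‖a i‖ = ‖b i‖) (u v : D) (hu : ‖u‖ = 1) (hv : ‖v‖ = 1)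
    (h : u * (List.ofFn a).prod = (List.ofFn b).prod * v) :
    ∃ e : ℕ → D, (∀ j, ‖e j‖ = 1) ∧ e 0 = u ∧ e n = v ∧
      ∀ i : Fin n, b i * e (i + 1) = e i * a i := by
  induction n generalizing u with
  | zero =>
    refine ⟨fun _ => u, fun _ => hu, rfl, ?_, fun i => i.elim0⟩
    simpa using h
  | succ n ih =>
    obtain ⟨w, hw, h0, hs⟩ : ∃ w : D, ‖w‖ = 1 ∧ b 0 * w = u * a 0 ∧
        w * (List.ofFn fun i : Fin n => a i.succ).prod =
          (List.ofFn fun i : Fin n => b i.succ).prod * v := by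
      rw [List.ofFn_succ, List.ofFn_succ, List.prod_cons, List.prod_cons] at h
      have hnorm : ‖(List.ofFn fun i : Fin n => a i.succ).prod‖ =
          ‖(List.ofFn fun i : Fin n => b i.succ).prod‖ := by
        simp [norm_list_ofFn_prod, hab]
      generalize (List.ofFn fun i : Fin n => a i.succ).prod = A at *
      generalize (List.ofFn fun i : Fin n => b i.succ).prod = B at *
      by_cases ha : a 0 = 0
      · have hb : b 0 = 0 := by rw [← norm_eq_zero, ← hab, ha, norm_zero]
        by_cases hA : A = 0
        · have hB : B = 0 := by rw [← norm_eq_zero, ← hnorm, hA, norm_zero]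
          exact ⟨1, by simp, by simp [ha, hb], by simp [hA, hB]⟩
        · refine ⟨B * v * A⁻¹, ?_, by simp [ha, hb], by rw [inv_mul_cancel_right₀ hA]⟩
          rw [norm_mul, norm_mul, norm_inv, hv, ← hnorm, mul_one,
            mul_inv_cancel₀ (norm_ne_zero_iff.2 hA)]
      · have hb : b 0 ≠ 0 := by rwa [← norm_ne_zero_iff, ← hab, norm_ne_zero_iff]
        refine ⟨(b 0)⁻¹ * (u * a 0), ?_, by rw [mul_inv_cancel_left₀ hb], ?_⟩
        · rw [norm_mul, norm_mul, norm_inv, hu, hab, one_mul,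
            inv_mul_cancel₀ (norm_ne_zero_iff.2 hb)]
        · rw [mul_assoc, mul_assoc, h, mul_assoc, inv_mul_cancel_left₀ hb]
    obtain ⟨e, he, he0, hen, hi⟩ :=
      ih (fun i => a i.succ) (fun i => b i.succ) (fun i => hab _) w hw hs
    refine ⟨fun j => Nat.casesOn j u e, ?_, rfl, hen, ?_⟩
    · rintro (_ | j)
      · exact hu
      · exact he j
    · intro i
      refine Fin.cases ?_ (fun i => ?_) i
      · simpa [he0] using h0
      · simpa using hi i

lemma exists_quaternion_prod_eq {n : ℕ} (s : Fin (n + 1) → ℝ) (hs : ∀ i, 0 ≤ s i) (p : ℍ[ℝ])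
    (hp : ‖p‖ = ∏ i, s i) :
    ∃ q : Fin (n + 1) → ℍ[ℝ], (∀ i, ‖q i‖ = s i) ∧ (List.ofFn q).prod = p := by
  obtain ⟨w, hw, hwp⟩ : ∃ w : ℍ[ℝ], ‖w‖ = 1 ∧ w * ((‖p‖ : ℝ) : ℍ[ℝ]) = p := by
    by_cases h : p = 0
    · exact ⟨1, by simp, by simp [h]⟩
    · have h' : ‖p‖ ≠ 0 := norm_ne_zero_iff.2 h
      have hc : ((‖p‖ : ℝ) : ℍ[ℝ]) ≠ 0 := by
        rw [← norm_ne_zero_iff, Quaternion.norm_coe]; simpa using h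
      refine ⟨p * ((‖p‖ : ℝ) : ℍ[ℝ])⁻¹, ?_, inv_mul_cancel_right₀ hc p⟩
      rw [norm_mul, norm_inv, Quaternion.norm_coe, norm_norm, mul_inv_cancel₀ h']
  refine ⟨Fin.cons (w * (s 0 : ℍ[ℝ])) fun i => (s i.succ : ℍ[ℝ]), fun i => ?_, ?_⟩
  · refine Fin.cases ?_ (fun i => ?_) i
    · simp [hw, Quaternion.norm_coe, abs_of_nonneg (hs 0)]
    · simp [Quaternion.norm_coe, abs_of_nonneg (hs i.succ)]
  · have h := map_list_prod (algebraMap ℝ ℍ[ℝ]) (List.ofFn fun i => s (Fin.succ i))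
    rw [List.map_ofFn, List.prod_ofFn] at h
    rw [List.ofFn_succ, List.prod_cons]
    simp only [Fin.cons_zero, Fin.cons_succ]
    have h' : (List.ofFn fun i : Fin n => (s i.succ : ℍ[ℝ])).prod
        = ((∏ i : Fin n, s i.succ : ℝ) : ℍ[ℝ]) := h.symm
    rw [h', mul_assoc, ← Quaternion.coe_mul, ← Fin.prod_univ_succ, ← hp, hwp]

lemma spRel_iff {k : ℕ} {m : Fin k → ℕ}
    (a b : ∀ i : Fin k,
      {p : EuclideanSpace ℝ (Fin (m i - 3)) × ℍ[ℝ] // ‖p.1‖ ^ 2 + ‖p.2‖ ^ 2 = 1}) :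
    spRel k m a b ↔ (∀ i, (b i).1.1 = (a i).1.1) ∧
      (List.ofFn fun i => (b i).1.2).prod = (List.ofFn fun i => (a i).1.2).prod := by
  constructor
  · rintro ⟨r, hr, h⟩
    refine ⟨fun i => (h i).1, ?_⟩
    have hne : ∀ j, chainExt k r j ≠ 0 := by
      intro j
      rw [chainExt]
      split_ifs
      · rw [← norm_ne_zero_iff, hr]; exact one_ne_zero
      · exact one_ne_zero
    have key := mul_prod_ofFn_eq_prod_ofFn_mul (fun i => (a i).1.2) (fun i => (b i).1.2)
      (chainExt k r) (fun i => by rw [(h i).2, inv_mul_cancel_right₀ (hne _)])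
    have h0 : chainExt k r 0 = 1 := by simp [chainExt]
    have hk : chainExt k r k = 1 := by
      rw [chainExt, dif_neg (by omega)]
    rw [h0, hk, one_mul, mul_one] at key
    exact key.symm
  · rintro ⟨hx, hq⟩
    have hab : ∀ i, ‖(a i).1.2‖ = ‖(b i).1.2‖ := by
      intro i
      have h1 := (a i).2
      have h2 := (b i).2
      rw [hx i] at h2
      exact (sq_eq_sq₀ (norm_nonneg _) (norm_nonneg _)).1 (by linarith)
    obtain ⟨e, he, he0, hek, hi⟩ := exists_chain_of_mul_prod_eq (fun i => (a i).1.2)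
      (fun i => (b i).1.2) hab 1 1 norm_one norm_one (by rw [one_mul, mul_one, hq])
    have hext : ∀ j, j ≤ k → chainExt k (fun j : Fin (k - 1) => e (j + 1)) j = e j := by
      intro j hj
      rw [chainExt]
      split_ifs with h
      · simp only
        congr 1
        omega
      · rcases Nat.eq_zero_or_pos j with rfl | hpos
        · exact he0.symm
        · obtain rfl : j = k := by omega
          exact hek.symm
    refine ⟨fun j => e (j + 1), fun j => he _, fun i => ⟨hx i, ?_⟩⟩
    have hne : e (i + 1) ≠ 0 := by rw [← norm_ne_zero_iff, he]; exact one_ne_zero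
    rw [hext _ i.2.le, hext _ i.2, ← hi i, mul_inv_cancel_right₀ hne]

/-- The complete invariant of an orbit: the real parts together with the ordered product of the
quaternionic parts. -/
def spInvariant (k : ℕ) (m : Fin k → ℕ)
    (a : ∀ i : Fin k,
      {p : EuclideanSpace ℝ (Fin (m i - 3)) × ℍ[ℝ] // ‖p.1‖ ^ 2 + ‖p.2‖ ^ 2 = 1}) :
    (∀ i, EuclideanSpace ℝ (Fin (m i - 3))) × ℍ[ℝ] :=
  (fun i => (a i).1.1, (List.ofFn fun i => (a i).1.2).prod)

lemma spRel_iff_spInvariant_eq {k : ℕ} {m : Fin k → ℕ}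
    (a b : ∀ i : Fin k,
      {p : EuclideanSpace ℝ (Fin (m i - 3)) × ℍ[ℝ] // ‖p.1‖ ^ 2 + ‖p.2‖ ^ 2 = 1}) :
    spRel k m a b ↔ spInvariant k m a = spInvariant k m b := by
  rw [spRel_iff, eq_comm (a := spInvariant k m a), spInvariant, spInvariant, Prod.mk.injEq,
    funext_iff]

lemma continuous_spInvariant (k : ℕ) (m : Fin k → ℕ) : Continuous (spInvariant k m) := by
  refine Continuous.prodMk (by fun_prop) ?_
  have h : ∀ n (f : Fin n → (∀ i : Fin k,
      {p : EuclideanSpace ℝ (Fin (m i - 3)) × ℍ[ℝ] // ‖p.1‖ ^ 2 + ‖p.2‖ ^ 2 = 1}) → ℍ[ℝ]),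
      (∀ i, Continuous (f i)) → Continuous fun a => (List.ofFn fun i => f i a).prod := by
    intro n
    induction n with
    | zero => intro f _; simpa using continuous_const
    | succ n ih =>
      intro f hf
      simp only [List.ofFn_succ, List.prod_cons]
      exact (hf 0).mul (ih (fun i => f i.succ) fun i => hf _)
  exact h k (fun i a => (a i).1.2) fun i => by fun_prop

lemma norm_sq_spInvariant_snd {k : ℕ} {m : Fin k → ℕ}
    (a : ∀ i : Fin k,
      {p : EuclideanSpace ℝ (Fin (m i - 3)) × ℍ[ℝ] // ‖p.1‖ ^ 2 + ‖p.2‖ ^ 2 = 1}) :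
    ‖(spInvariant k m a).2‖ ^ 2 = ∏ i, (1 - ‖(spInvariant k m a).1 i‖ ^ 2) := by
  simp only [spInvariant, norm_list_ofFn_prod, ← Finset.prod_pow]
  exact Finset.prod_congr rfl fun i _ => eq_sub_of_add_eq' (a i).2

lemma norm_spInvariant_fst_le {k : ℕ} {m : Fin k → ℕ}
    (a : ∀ i : Fin k,
      {p : EuclideanSpace ℝ (Fin (m i - 3)) × ℍ[ℝ] // ‖p.1‖ ^ 2 + ‖p.2‖ ^ 2 = 1}) (i : Fin k) :
    ‖(spInvariant k m a).1 i‖ ^ 2 ≤ 1 := by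
  have h := (a i).2
  simp only [spInvariant]
  nlinarith [sq_nonneg ‖(a i).1.2‖]

lemma spInvariant_ne_zero {k : ℕ} {m : Fin k → ℕ}
    (a : ∀ i : Fin k,
      {p : EuclideanSpace ℝ (Fin (m i - 3)) × ℍ[ℝ] // ‖p.1‖ ^ 2 + ‖p.2‖ ^ 2 = 1}) :
    spInvariant k m a ≠ 0 := by
  intro h
  have := norm_sq_spInvariant_snd a
  simp [h] at this

/-- A ray from the origin meets the image of the invariant at most once: it cannot do so at a
point and at a larger multiple of it. -/
lemma le_one_of_spInvariant_eq_smul {k : ℕ} {m : Fin k → ℕ}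
    {a b : ∀ i : Fin k,
      {p : EuclideanSpace ℝ (Fin (m i - 3)) × ℍ[ℝ] // ‖p.1‖ ^ 2 + ‖p.2‖ ^ 2 = 1}}
    {c : ℝ} (h : spInvariant k m b = c • spInvariant k m a) : c ≤ 1 := by
  by_contra! hc
  have hc2 : 1 < c ^ 2 := by nlinarith
  have h1 : ∀ i, ‖(spInvariant k m b).1 i‖ ^ 2 = c ^ 2 * ‖(spInvariant k m a).1 i‖ ^ 2 := by
    intro i
    simp [h, norm_smul, mul_pow]
  have h2 : ‖(spInvariant k m b).2‖ ^ 2 = c ^ 2 * ‖(spInvariant k m a).2‖ ^ 2 := by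
    simp [h, norm_smul, mul_pow]
  have hle : ‖(spInvariant k m b).2‖ ^ 2 ≤ ‖(spInvariant k m a).2‖ ^ 2 := by
    rw [norm_sq_spInvariant_snd, norm_sq_spInvariant_snd]
    refine Finset.prod_le_prod (fun i _ => sub_nonneg.2 (norm_spInvariant_fst_le b i))
      fun i _ => ?_
    rw [h1]
    nlinarith [sq_nonneg ‖(spInvariant k m a).1 i‖]
  have hz : ‖(spInvariant k m a).2‖ ^ 2 = 0 := by
    nlinarith [sq_nonneg ‖(spInvariant k m a).2‖]
  rw [norm_sq_spInvariant_snd, Finset.prod_eq_zero_iff] at hz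
  obtain ⟨i, -, hi⟩ := hz
  have := norm_spInvariant_fst_le b i
  rw [h1] at this
  nlinarith

lemma spInvariant_eq_of_eq_smul {k : ℕ} {m : Fin k → ℕ}
    {a b : ∀ i : Fin k,
      {p : EuclideanSpace ℝ (Fin (m i - 3)) × ℍ[ℝ] // ‖p.1‖ ^ 2 + ‖p.2‖ ^ 2 = 1}}
    {c : ℝ} (hc : 0 < c) (h : spInvariant k m b = c • spInvariant k m a) :
    spInvariant k m a = spInvariant k m b := by
  have h1 := le_one_of_spInvariant_eq_smul h
  have h2 : c⁻¹ ≤ 1 := le_one_of_spInvariant_eq_smul (a := b) (b := a)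
    (by rw [h, inv_smul_smul₀ hc.ne'])
  have h3 : 1 ≤ c := (inv_le_one₀ hc).1 h2
  rw [h, le_antisymm h1 h3, one_smul]

/-- Every ray from the origin meets the image of the invariant. -/
lemma exists_spInvariant_eq_smul {k : ℕ} (hk : k ≠ 0) {m : Fin k → ℕ}
    (y : (∀ i, EuclideanSpace ℝ (Fin (m i - 3))) × ℍ[ℝ]) (hy : y ≠ 0) :
    ∃ t : ℝ, 0 < t ∧ ∃ a, spInvariant k m a = t • y := by
  obtain ⟨u, v⟩ := y
  obtain ⟨t, ht, hle, heq⟩ : ∃ t : ℝ, 0 < t ∧ (∀ i, t * ‖u i‖ ≤ 1) ∧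
      (t * ‖v‖) ^ 2 = ∏ i, (1 - (t * ‖u i‖) ^ 2) := by
    by_cases hu : u = 0
    · have hv : v ≠ 0 := fun hv => hy (by rw [hu, hv]; rfl)
      have hv' : 0 < ‖v‖ := norm_pos_iff.2 hv
      exact ⟨‖v‖⁻¹, inv_pos.2 hv', by simp [hu], by simp [hu, hv'.ne']⟩
    · have hN : 0 < ‖u‖ := norm_pos_iff.2 hu
      have : Nonempty (Fin k) := ⟨⟨0, Nat.pos_of_ne_zero hk⟩⟩
      obtain ⟨j, hj⟩ : ∃ j, ‖u‖ = ‖u j‖ := by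
        obtain ⟨j, -, hj⟩ := Finset.exists_max_image Finset.univ (fun i => ‖u i‖)
          Finset.univ_nonempty
        exact ⟨j, le_antisymm ((pi_norm_le_iff_of_nonneg (norm_nonneg _)).2
          fun i => hj i (Finset.mem_univ i)) (norm_le_pi_norm u j)⟩
      have hcont : ContinuousOn (fun t : ℝ => ∏ i, (1 - (t * ‖u i‖) ^ 2) - (t * ‖v‖) ^ 2)
          (Set.Icc 0 ‖u‖⁻¹) := by fun_prop
      obtain ⟨t, ⟨ht0, ht1⟩, ht⟩ := intermediate_value_Icc' (inv_pos.2 hN).le hcont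
        (show (0 : ℝ) ∈ Set.Icc _ _ by
          refine ⟨?_, by simp⟩
          have : ∏ i, (1 - (‖u‖⁻¹ * ‖u i‖) ^ 2) = 0 :=
            Finset.prod_eq_zero (Finset.mem_univ j) (by rw [← hj, inv_mul_cancel₀ hN.ne']; simp)
          simp only [this, zero_sub, neg_nonpos]
          positivity)
      refine ⟨t, ht0.lt_of_ne ?_, fun i => ?_, (sub_eq_zero.1 ht).symm⟩
      · rintro rfl
        simp at ht
      · calc t * ‖u i‖ ≤ ‖u‖⁻¹ * ‖u‖ := by gcongr; exact norm_le_pi_norm u i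
          _ = 1 := inv_mul_cancel₀ hN.ne'
  obtain ⟨n, rfl⟩ := Nat.exists_eq_succ_of_ne_zero hk
  have hnn : ∀ i, 0 ≤ 1 - (t * ‖u i‖) ^ 2 := fun i =>
    sub_nonneg.2 (pow_le_one₀ (by positivity) (hle i))
  obtain ⟨q, hq, hprod⟩ := exists_quaternion_prod_eq (fun i => √(1 - (t * ‖u i‖) ^ 2))
    (fun i => Real.sqrt_nonneg _) (t • v) (by
      rw [← Real.sqrt_prod _ fun i _ => hnn i, ← heq, Real.sqrt_sq (by positivity), norm_smul,
        Real.norm_of_nonneg ht.le])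
  refine ⟨t, ht, fun i => ⟨(t • u i, q i), ?_⟩, ?_⟩
  · simp only [hq, Real.sq_sqrt (hnn i), norm_smul, Real.norm_of_nonneg ht.le]
    ring
  · exact Prod.ext rfl hprod

lemma compactSpace_norm_sq_add_norm_sq_eq_one (E F : Type*) [NormedAddCommGroup E]
    [NormedAddCommGroup F] [ProperSpace E] [ProperSpace F] :
    CompactSpace {p : E × F // ‖p.1‖ ^ 2 + ‖p.2‖ ^ 2 = 1} := by
  refine isCompact_iff_compactSpace.1 (Metric.isCompact_of_isClosed_isBounded
    (isClosed_eq (by fun_prop) continuous_const)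
    (Metric.isBounded_closedBall (x := 0) (r := 1) |>.subset fun p hp => ?_))
  have hp : ‖p.1‖ ^ 2 + ‖p.2‖ ^ 2 = 1 := hp
  rw [mem_closedBall_zero_iff, Prod.norm_def, max_le_iff]
  constructor <;> nlinarith [sq_nonneg ‖p.1‖, sq_nonneg ‖p.2‖]

/-- A continuous surjection from a compact space to a Hausdorff space identifies the target with
the quotient by the relation of having the same image. -/
lemma nonempty_quot_homeomorph {X Y : Type*} [TopologicalSpace X] [TopologicalSpace Y]
    [CompactSpace X] [T2Space Y] (r : X → X → Prop) (f : X → Y) (hf : Continuous f)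
    (hsurj : Function.Surjective f) (hr : ∀ a b, r a b ↔ f a = f b) :
    Nonempty (Quot r ≃ₜ Y) := by
  let g : Quot r → Y := Quot.lift f fun a b h => (hr a b).1 h
  have hg : Continuous g := continuous_quot_lift _ hf
  have hbij : Function.Bijective g := by
    refine ⟨?_, fun y => ?_⟩
    · rintro ⟨a⟩ ⟨b⟩ h
      exact Quot.sound ((hr a b).2 h)
    · obtain ⟨a, ha⟩ := hsurj y
      exact ⟨Quot.mk r a, ha⟩
  exact ⟨Continuous.homeoOfEquivCompactToT2 (f := Equiv.ofBijective g hbij) hg⟩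

lemma finrank_pi_euclideanSpace_prod_quaternion {k : ℕ} (hk : k ≠ 0) (m : Fin k → ℕ)
    (hm : ∀ i, 3 ≤ m i) :
    Module.finrank ℝ ((∀ i, EuclideanSpace ℝ (Fin (m i - 3))) × ℍ[ℝ]) =
      (∑ i, m i) - 3 * (k - 1) + 1 := by
  have hsum : ∑ i, (m i - 3) + 3 * k = ∑ i, m i := by
    have h : ∑ i, (m i - 3 + 3) = ∑ i, m i :=
      Finset.sum_congr rfl fun i _ => Nat.sub_add_cancel (hm i)
    rw [← h, Finset.sum_add_distrib]
    simp [mul_comm]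
  rw [Module.finrank_prod, Module.finrank_pi_fintype, Quaternion.finrank_eq_four]
  simp only [finrank_euclideanSpace_fin]
  omega

/-- for `k ≥ 2` and `m i ≥ 4`, the orbit space
`(S^{m₁} × ⋯ × S^{m_k})/Sp(1)^{k-1}` is homeomorphic to the sphere `S^m`,
`m = m₁ + ⋯ + m_k - 3(k-1)`. -/
theorem stmt4 (k : ℕ) (hk : 2 ≤ k) (m : Fin k → ℕ) (hm : ∀ i, 4 ≤ m i) :
    Nonempty (Quot (spRel k m) ≃ₜ
      Metric.sphere (0 : EuclideanSpace ℝ (Fin ((∑ i, m i) - 3 * (k - 1) + 1))) 1) := by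
  have hk0 : k ≠ 0 := by omega
  let L : ((∀ i, EuclideanSpace ℝ (Fin (m i - 3))) × ℍ[ℝ]) ≃L[ℝ]
      EuclideanSpace ℝ (Fin ((∑ i, m i) - 3 * (k - 1) + 1)) :=
    ContinuousLinearEquiv.ofFinrankEq (by
      rw [finrank_pi_euclideanSpace_prod_quaternion hk0 m fun i => by linarith [hm i],
        finrank_euclideanSpace_fin])
  have hpos : ∀ a, 0 < ‖L (spInvariant k m a)‖ := fun a =>
    norm_pos_iff.2 (L.map_ne_zero_iff.2 (spInvariant_ne_zero a))
  have := fun i => compactSpace_norm_sq_add_norm_sq_eq_one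
    (EuclideanSpace ℝ (Fin (m i - 3))) ℍ[ℝ]
  have hLc : Continuous fun a => L (spInvariant k m a) :=
    L.continuous.comp (continuous_spInvariant k m)
  refine nonempty_quot_homeomorph (spRel k m)
    (fun a => ⟨‖L (spInvariant k m a)‖⁻¹ • L (spInvariant k m a), ?_⟩) ?_ ?_ ?_
  · rw [mem_sphere_zero_iff_norm, norm_smul, norm_inv, norm_norm, inv_mul_cancel₀ (hpos a).ne']
  · exact ((hLc.norm.inv₀ fun a => (hpos a).ne').smul hLc).subtype_mk _
  · rintro ⟨y, hy⟩
    rw [mem_sphere_zero_iff_norm] at hy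
    obtain ⟨t, ht, a, ha⟩ := exists_spInvariant_eq_smul hk0 (L.symm y) (by
      refine L.symm.toLinearEquiv.map_ne_zero_iff.2 ?_
      rintro rfl
      simp at hy)
    refine ⟨a, Subtype.ext ?_⟩
    simp only [ha, map_smul, L.apply_symm_apply, norm_smul, hy, mul_one,
      Real.norm_of_nonneg ht.le, inv_smul_smul₀ ht.ne']
  · intro a b
    rw [spRel_iff_spInvariant_eq, Subtype.mk.injEq]
    refine ⟨fun h => by rw [h], fun h => ?_⟩
    refine spInvariant_eq_of_eq_smul
      (c := ‖L (spInvariant k m b)‖ * ‖L (spInvariant k m a)‖⁻¹)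
      (mul_pos (hpos b) (inv_pos.2 (hpos a))) (L.injective ?_)
    rw [map_smul, mul_smul, h, smul_inv_smul₀ (hpos b).ne']
end
end

section
/- Let k ≥ 2. Consider the action of the torus U(1)^{k−1} on ℂ^k in which (g₁,…,g_{k−1}) sends (q₁,…,q_k) to (q₁g₁⁻¹, g₁q₂g₂⁻¹, …, g_{k−2}q_{k−1}g_{k−1}⁻¹, g_{k−1}q_k). Then the orbit space ℂ^k/U(1)^{k−1} is homeomorphic to ℝ^{k+1}. -/
noncomputable section

/-- The orbit relation of the chain action of the norm-one elements `S(𝕂)^{k-1}` on `𝕂^k`,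
where `(g₁,…,g_{k-1})` sends `(q₁,…,q_k)` to `(q₁g₁⁻¹, g₁q₂g₂⁻¹, …, g_{k-1}q_k)`. -/
def chainRel (K : Type*) [DivisionRing K] [Norm K] (k : ℕ) (a b : Fin k → K) : Prop :=
  ∃ g : Fin (k - 1) → K, (∀ j, ‖g j‖ = 1) ∧
    ∀ i : Fin k, b i = chainExt k g (i : ℕ) * a i * (chainExt k g ((i : ℕ) + 1))⁻¹

/-- The product of the coordinates together with the differences of their squared norms. -/
def chainInvariant (n : ℕ) (q : Fin (n + 1) → ℂ) : ℂ × (Fin n → ℝ) :=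
  (∏ i, q i, fun i => ‖q i.succ‖ ^ 2 - ‖q 0‖ ^ 2)

theorem continuous_chainInvariant (n : ℕ) : Continuous (chainInvariant n) := by
  unfold chainInvariant
  fun_prop

theorem chainExt_zero {G : Type*} [One G] (k : ℕ) (r : Fin (k - 1) → G) :
    chainExt k r 0 = 1 := by
  simp [chainExt]

theorem chainExt_succ_self {G : Type*} [One G] (n : ℕ) (r : Fin (n + 1 - 1) → G) :
    chainExt (n + 1) r (n + 1) = 1 := by
  simp [chainExt]

theorem norm_chainExt {k : ℕ} {r : Fin (k - 1) → ℂ} (hr : ∀ j, ‖r j‖ = 1) (j : ℕ) :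
    ‖chainExt k r j‖ = 1 := by
  unfold chainExt
  split_ifs
  · exact hr _
  · exact norm_one

theorem norm_eq_of_chainRel {k : ℕ} {a b : Fin k → ℂ} (h : chainRel ℂ k a b) (i : Fin k) :
    ‖b i‖ = ‖a i‖ := by
  obtain ⟨g, hg, hb⟩ := h
  simp [hb i, norm_chainExt hg]

theorem prod_eq_of_chainRel {n : ℕ} {a b : Fin (n + 1) → ℂ} (h : chainRel ℂ (n + 1) a b) :
    ∏ i, b i = ∏ i, a i := by
  obtain ⟨g, hg, hb⟩ := h
  have hne : ∀ j, chainExt (n + 1) g j ≠ 0 := fun j => by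
    rw [← norm_ne_zero_iff, norm_chainExt hg]
    exact one_ne_zero
  have htel : ∀ m, ∏ i ∈ Finset.range m,
      (chainExt (n + 1) g i * (chainExt (n + 1) g (i + 1))⁻¹) =
        (chainExt (n + 1) g m)⁻¹ := by
    intro m
    induction m with
    | zero => simp [chainExt_zero]
    | succ m ih =>
      rw [Finset.prod_range_succ, ih, inv_mul_cancel_left₀ (hne m)]
  calc ∏ i, b i
      = ∏ i : Fin (n + 1), (chainExt (n + 1) g (i : ℕ) *
          (chainExt (n + 1) g ((i : ℕ) + 1))⁻¹) * a i :=
        Finset.prod_congr rfl fun i _ => by rw [hb i]; ring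
    _ = ∏ i, a i := by
        rw [Finset.prod_mul_distrib, Fin.prod_univ_eq_prod_range
          (fun j => chainExt (n + 1) g j * (chainExt (n + 1) g (j + 1))⁻¹), htel,
          chainExt_succ_self, inv_one, one_mul]

theorem chainInvariant_eq_of_chainRel {n : ℕ} {a b : Fin (n + 1) → ℂ}
    (h : chainRel ℂ (n + 1) a b) : chainInvariant n a = chainInvariant n b := by
  simp only [chainInvariant, prod_eq_of_chainRel h, norm_eq_of_chainRel h]

/-- Coordinatewise rotation by phases of total product one is realised by the chain action. -/
theorem chainRel_of_phases {n : ℕ} {a b u : Fin (n + 1) → ℂ} (hu : ∀ i, ‖u i‖ = 1)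
    (hprod : ∏ i, u i = 1) (hb : ∀ i, b i = u i * a i) : chainRel ℂ (n + 1) a b := by
  let v : ℕ → ℂ := fun j => if h : j < n + 1 then u ⟨j, h⟩ else 1
  have hv : ∀ j, ‖v j‖ = 1 := fun j => by
    dsimp only [v]
    split_ifs
    exacts [hu _, norm_one]
  let G : ℕ → ℂ := fun j => (∏ i ∈ Finset.range j, v i)⁻¹
  have hG : ∀ j, ‖G j‖ = 1 := fun j => by simp [G, norm_prod, hv]
  have hGne : ∀ j, G j ≠ 0 := fun j => by
    rw [← norm_ne_zero_iff, hG]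
    exact one_ne_zero
  have hvi : ∀ i : Fin (n + 1), v i = u i := fun i => dif_pos i.isLt
  have hGlast : G (n + 1) = 1 := by
    have : ∏ i ∈ Finset.range (n + 1), v i = ∏ i, u i := by
      rw [← Fin.prod_univ_eq_prod_range]
      exact Finset.prod_congr rfl fun i _ => hvi i
    simp [G, this, hprod]
  let g : Fin (n + 1 - 1) → ℂ := fun j => G ((j : ℕ) + 1)
  have hext : ∀ j, j ≤ n + 1 → chainExt (n + 1) g j = G j := by
    intro j hj
    rcases Nat.eq_zero_or_pos j with rfl | hpos
    · simp [chainExt_zero, G]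
    rcases hj.eq_or_lt with rfl | hlt
    · rw [chainExt_succ_self, hGlast]
    have h : 1 ≤ j ∧ j ≤ n + 1 - 1 := by omega
    simp only [chainExt, h, and_self, dif_pos, g]
    congr 1
    omega
  refine ⟨g, fun j => hG _, fun i => ?_⟩
  rw [hext i (by omega), hext (i + 1) (by omega), hb i]
  have hstep : (G ((i : ℕ) + 1))⁻¹ = (G i)⁻¹ * u i := by
    simp only [G, inv_inv, Finset.prod_range_succ, hvi i]
  rw [hstep]
  field_simp [hGne i]

theorem chainRel_of_norm_eq_of_prod_eq {n : ℕ} {a b : Fin (n + 1) → ℂ}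
    (hnorm : ∀ i, ‖a i‖ = ‖b i‖) (hprod : ∏ i, a i = ∏ i, b i) :
    chainRel ℂ (n + 1) a b := by
  let w : Fin (n + 1) → ℂ := fun i => if a i = 0 then 1 else b i / a i
  have hw : ∀ i, ‖w i‖ = 1 := fun i => by
    by_cases h : a i = 0
    · simp [w, h]
    · simp [w, h, ← hnorm i]
  have hwb : ∀ i, b i = w i * a i := fun i => by
    by_cases h : a i = 0
    · have hbi : b i = 0 := by rw [← norm_eq_zero, ← hnorm i, h, norm_zero]
      simp [h, hbi]
    · simp [w, h]
  by_cases h0 : ∃ i, a i = 0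
  · obtain ⟨i₀, hi₀⟩ := h0
    let P : ℂ := ∏ i ∈ Finset.univ \ {i₀}, w i
    have hP : ‖P‖ = 1 := by simp only [P, norm_prod, hw, Finset.prod_const_one]
    have hPne : P ≠ 0 := by
      rw [← norm_ne_zero_iff, hP]
      exact one_ne_zero
    refine chainRel_of_phases (u := Function.update w i₀ P⁻¹) (fun i => ?_) ?_ fun i => ?_
    · rcases eq_or_ne i i₀ with rfl | hi
      · simp [hP]
      · simp [hi, hw]
    · rw [Finset.prod_update_of_mem (Finset.mem_univ _)]
      exact inv_mul_cancel₀ hPne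
    · rcases eq_or_ne i i₀ with rfl | hi
      · rw [hwb i, hi₀, mul_zero, mul_zero]
      · simp only [Function.update_of_ne hi, hwb i]
  · push Not at h0
    refine chainRel_of_phases hw ?_ hwb
    have hne : ∏ i, a i ≠ 0 := Finset.prod_ne_zero_iff.2 fun i _ => h0 i
    apply mul_right_cancel₀ hne
    rw [← Finset.prod_mul_distrib, one_mul, hprod]
    exact Finset.prod_congr rfl fun i _ => (hwb i).symm

theorem prod_lt_prod_add {ι : Type*} [Fintype ι] [Nonempty ι] {s : ι → ℝ} {c : ℝ}
    (hs : ∀ i, 0 ≤ s i) (hc : 0 < c) : ∏ i, s i < ∏ i, (s i + c) := by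
  by_cases h : ∃ i, s i = 0
  · obtain ⟨i, hi⟩ := h
    rw [Finset.prod_eq_zero (Finset.mem_univ i) hi]
    exact Finset.prod_pos fun j _ => add_pos_of_nonneg_of_pos (hs j) hc
  · push Not at h
    exact Finset.prod_lt_prod_of_nonempty (fun i _ => (hs i).lt_of_ne' (h i))
      (fun i _ => lt_add_of_pos_right _ hc) Finset.univ_nonempty

theorem norm_sq_zero_le_of_chainInvariant_eq {n : ℕ} {a b : Fin (n + 1) → ℂ}
    (h : chainInvariant n a = chainInvariant n b) : ‖b 0‖ ^ 2 ≤ ‖a 0‖ ^ 2 := by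
  by_contra! hlt
  obtain ⟨hp, hd⟩ := Prod.ext_iff.1 h
  have hb : ∀ i, ‖b i‖ ^ 2 = ‖a i‖ ^ 2 + (‖b 0‖ ^ 2 - ‖a 0‖ ^ 2) := by
    intro i
    refine Fin.cases (by ring) (fun i => ?_) i
    have := congrFun hd i
    simp only [chainInvariant] at this
    linarith
  have hlt' := prod_lt_prod_add (s := fun i => ‖a i‖ ^ 2) (fun i => sq_nonneg _)
    (sub_pos.2 hlt)
  simp only [← hb, Finset.prod_pow, ← norm_prod] at hlt'
  simp only [chainInvariant] at hp
  rw [hp] at hlt'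
  exact lt_irrefl _ hlt'

theorem chainRel_of_chainInvariant_eq {n : ℕ} {a b : Fin (n + 1) → ℂ}
    (h : chainInvariant n a = chainInvariant n b) : chainRel ℂ (n + 1) a b := by
  have h0 := le_antisymm (norm_sq_zero_le_of_chainInvariant_eq h.symm)
    (norm_sq_zero_le_of_chainInvariant_eq h)
  obtain ⟨hp, hd⟩ := Prod.ext_iff.1 h
  refine chainRel_of_norm_eq_of_prod_eq (fun i => ?_) hp
  rw [← sq_eq_sq₀ (norm_nonneg _) (norm_nonneg _)]
  refine Fin.cases h0 (fun i => ?_) i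
  have := congrFun hd i
  simp only [chainInvariant] at this
  linarith

theorem exists_prod_add_eq {n : ℕ} (e : Fin (n + 1) → ℝ) {y : ℝ} (hy : 0 ≤ y) :
    ∃ t, (∀ i, 0 ≤ t + e i) ∧ ∏ i, (t + e i) = y := by
  obtain ⟨i₀, hi₀⟩ := Finite.exists_min e
  have hcont : Continuous fun t : ℝ => ∏ i, (t + e i) := by fun_prop
  have hle : -e i₀ ≤ -e i₀ + (1 + y) := by linarith
  have hlow : ∏ i, (-e i₀ + e i) = 0 :=
    Finset.prod_eq_zero (Finset.mem_univ i₀) (neg_add_cancel _)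
  have hhigh : y ≤ ∏ i, (-e i₀ + (1 + y) + e i) := by
    calc y ≤ 1 + y := by linarith
      _ ≤ (1 + y) ^ (n + 1) := le_self_pow₀ (by linarith) n.succ_ne_zero
      _ = ∏ _i : Fin (n + 1), (1 + y) := by simp
      _ ≤ _ := Finset.prod_le_prod (fun _ _ => by linarith) fun i _ => by linarith [hi₀ i]
  obtain ⟨t, ht, hty⟩ := intermediate_value_Icc hle hcont.continuousOn
    (show y ∈ Set.Icc _ _ from ⟨hlow.trans_le hy, hhigh⟩)
  exact ⟨t, fun i => by linarith [hi₀ i, ht.1], hty⟩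

theorem chainInvariant_surjective (n : ℕ) : Function.Surjective (chainInvariant n) := by
  rintro ⟨p, d⟩
  let e : Fin (n + 1) → ℝ := Fin.cons 0 d
  obtain ⟨t, ht, hprod⟩ := exists_prod_add_eq e (sq_nonneg ‖p‖)
  let u : ℂ := Complex.exp (p.arg * Complex.I)
  have hu : ‖u‖ = 1 := Complex.norm_exp_ofReal_mul_I _
  let q : Fin (n + 1) → ℂ := fun i => (if i = 0 then u else 1) * (√(t + e i) : ℝ)
  have hq : ∀ i, ‖q i‖ ^ 2 = t + e i := fun i => by
    have h1 : ‖(if i = 0 then u else 1)‖ = 1 := by split_ifs <;> simp [hu]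
    rw [norm_mul, h1, one_mul, Complex.norm_real, Real.norm_of_nonneg (Real.sqrt_nonneg _),
      Real.sq_sqrt (ht i)]
  refine ⟨q, Prod.ext ?_ (funext fun i => ?_)⟩
  · have hsqrt : ∏ i, √(t + e i) = ‖p‖ := by
      rw [← Real.sqrt_prod _ fun i _ => ht i, hprod, Real.sqrt_sq (norm_nonneg _)]
    change ∏ i, q i = p
    rw [Finset.prod_mul_distrib, ← Complex.ofReal_prod, hsqrt, Finset.prod_ite_eq' Finset.univ
      (0 : Fin (n + 1)) fun _ => u, if_pos (Finset.mem_univ _), mul_comm]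
    exact Complex.norm_mul_exp_arg_mul_I p
  · change ‖q i.succ‖ ^ 2 - ‖q 0‖ ^ 2 = d i
    rw [hq, hq]
    simp [e]

theorem norm_le_of_norm_chainInvariant_le {n : ℕ} {q : Fin (n + 1) → ℂ} {R : ℝ}
    (h : ‖chainInvariant n q‖ ≤ R) : ‖q‖ ≤ R ^ 2 + 2 * R + 2 := by
  have hR : 0 ≤ R := (norm_nonneg _).trans h
  obtain ⟨hp, hd⟩ := norm_prod_le_iff.1 h
  replace hd : ∀ i, |‖q i‖ ^ 2 - ‖q 0‖ ^ 2| ≤ R := by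
    intro i
    refine Fin.cases (by simpa using hR) (fun i => ?_) i
    exact (norm_le_pi_norm (chainInvariant n q).2 i).trans hd
  have h0 : ‖q 0‖ ^ 2 ≤ R ^ 2 + R + 1 := by
    by_contra! hlt
    have hpow : (R ^ 2 + 1) ^ (n + 1) ≤ R ^ 2 := by
      calc (R ^ 2 + 1) ^ (n + 1) = ∏ _i : Fin (n + 1), (R ^ 2 + 1) := by simp
        _ ≤ ∏ i, ‖q i‖ ^ 2 := Finset.prod_le_prod (fun _ _ => by positivity)
            fun i _ => by linarith [(abs_le.1 (hd i)).1]
        _ = ‖∏ i, q i‖ ^ 2 := by rw [norm_prod, Finset.prod_pow]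
        _ ≤ R ^ 2 := pow_le_pow_left₀ (norm_nonneg _) hp 2
    have : R ^ 2 + 1 ≤ (R ^ 2 + 1) ^ (n + 1) :=
      le_self_pow₀ (by nlinarith) n.succ_ne_zero
    linarith
  refine (pi_norm_le_iff_of_nonneg (by positivity)).2 fun i => ?_
  nlinarith [(abs_le.1 (hd i)).2, sq_nonneg (‖q i‖ - 1), norm_nonneg (q i)]

theorem isProperMap_chainInvariant (n : ℕ) : IsProperMap (chainInvariant n) := by
  refine isProperMap_iff_isCompact_preimage.2 ⟨continuous_chainInvariant n, fun K hK => ?_⟩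
  obtain ⟨R, hR⟩ := hK.isBounded.exists_norm_le
  refine Metric.isCompact_of_isClosed_isBounded
    (hK.isClosed.preimage (continuous_chainInvariant n)) (isBounded_iff_forall_norm_le.2
      ⟨R ^ 2 + 2 * R + 2, fun q hq => norm_le_of_norm_chainInvariant_le (hR _ hq)⟩)

theorem isHomeomorph_lift_chainInvariant (n : ℕ) :
    IsHomeomorph (Quot.lift (r := chainRel ℂ (n + 1)) (chainInvariant n)
      fun _ _ => chainInvariant_eq_of_chainRel) := by
  refine isHomeomorph_iff_continuous_isClosedMap_bijective.2
    ⟨continuous_quot_lift _ (continuous_chainInvariant n), fun C hC => ?_, ?_, ?_⟩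
  · have himage : Quot.lift (r := chainRel ℂ (n + 1)) (chainInvariant n)
        (fun _ _ => chainInvariant_eq_of_chainRel) '' C =
          chainInvariant n '' (Quot.mk _ ⁻¹' C) := by
      conv_lhs => rw [← Set.image_preimage_eq C Quot.mk_surjective, Set.image_image]
    rw [himage]
    exact (isProperMap_chainInvariant n).isClosedMap _ (hC.preimage continuous_quot_mk)
  · rintro ⟨a⟩ ⟨b⟩ h
    exact Quot.sound (chainRel_of_chainInvariant_eq h)
  · intro y
    obtain ⟨q, hq⟩ := chainInvariant_surjective n y
    exact ⟨Quot.mk _ q, hq⟩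

/-- for `k ≥ 2`, the orbit space `ℂ^k/U(1)^{k-1}` of the chain action of the
torus `U(1)^{k-1}` on `ℂ^k` is homeomorphic to `ℝ^{k+1}`. -/
theorem stmt13 (k : ℕ) (hk : 2 ≤ k) :
    Nonempty (Quot (chainRel ℂ k) ≃ₜ EuclideanSpace ℝ (Fin (k + 1))) := by
  obtain ⟨n, rfl⟩ : ∃ n, k = n + 1 := ⟨k - 1, by omega⟩
  have hrank : Module.finrank ℝ (ℂ × (Fin n → ℝ)) =
      Module.finrank ℝ (EuclideanSpace ℝ (Fin (n + 1 + 1))) := by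
    rw [Module.finrank_prod, Complex.finrank_real_complex, Module.finrank_fin_fun,
      finrank_euclideanSpace_fin]
    omega
  exact ⟨(isHomeomorph_lift_chainInvariant n).homeomorph.trans
    (ContinuousLinearEquiv.ofFinrankEq hrank).toHomeomorph⟩
end
end

section
/- Let k ≥ 2, m₁,…,m_k ≥ 1 and m = m₁ + ⋯ + m_k, and let p : S^{m₁} × ⋯ × S^{m_k} → S^m ⊂ ℝ^{m+1} be the map sending ((x_{1,1},…,x_{m₁,1},q₁),…,(x_{1,k},…,x_{m_k,k},q_k)) to (x_{1,1},…,x_{m₁,1},…,x_{1,k},…,x_{m_k,k}, q₁q₂⋯q_k)/√(Σ_{i,j} x_{j,i}² + (q₁q₂⋯q_k)²), where q_i denotes the last coordinate of the i-th sphere factor. Then p is a local homeomorphism at every point for which at most one of the coordinates q₁, …, q_k is zero; that is, p restricted to the open set U = {points with at most one q_i equal to 0} is a local homeomorphism on U. -/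
open scoped BigOperators

noncomputable section

/-- The ambient Euclidean space `ℝ^{m₁} × ⋯ × ℝ^{m_k} × ℝ ≅ ℝ^{m+1}` with its `L²`-norm,
containing the target sphere `S^m`, `m = m₁ + ⋯ + m_k`. -/
abbrev RTarget (k : ℕ) (m : Fin k → ℕ) : Type :=
  WithLp 2 ((PiLp 2 fun i : Fin k => EuclideanSpace ℝ (Fin (m i))) × ℝ)

/-- The unnormalized vector `(x_{1,1}, …, x_{m₁,1}, …, x_{1,k}, …, x_{m_k,k}, q₁q₂⋯q_k)`,
where `q_i` is the last coordinate of the `i`-th sphere factor. -/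
def rVec (k : ℕ) (m : Fin k → ℕ)
    (a : ∀ i : Fin k, {y : EuclideanSpace ℝ (Fin (m i + 1)) // ‖y‖ = 1}) : RTarget k m :=
  (WithLp.equiv 2 _).symm
    ((WithLp.equiv 2 _).symm
        (fun i => (WithLp.equiv 2 _).symm fun j : Fin (m i) => (a i).1 j.castSucc),
      ∏ i, (a i).1 (Fin.last (m i)))

/-- The normalized map of Statement 18, as a map to the ambient space. -/
def rProj (k : ℕ) (m : Fin k → ℕ)
    (a : ∀ i : Fin k, {y : EuclideanSpace ℝ (Fin (m i + 1)) // ‖y‖ = 1}) : RTarget k m :=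
  ‖rVec k m a‖⁻¹ • rVec k m a

open Topology Filter Finset

/-- A scalar implicit function principle: a continuous function crossing the level `c` upwards
at `r₀` along the slice `z₀` also attains `c` near `r₀` on all nearby slices. -/
lemma eventually_exists_eq_of_crossing {X : Type*} [TopologicalSpace X] {H : X × ℝ → ℝ} {c : ℝ}
    {z₀ : X} {r₀ : ℝ} {S : Set (X × ℝ)} (hS : S ∈ 𝓝 (z₀, r₀))
    (hc : ∀ w ∈ S, ContinuousAt H w)
    (hlt : ∀ r < r₀, (z₀, r) ∈ S → H (z₀, r) < c)
    (hgt : ∀ r > r₀, (z₀, r) ∈ S → c < H (z₀, r)) :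
    ∀ᶠ z in 𝓝 z₀, ∃ r, (z, r) ∈ S ∧ H (z, r) = c := by
  obtain ⟨u, hu, v, hv, huv⟩ := mem_nhds_prod_iff.1 hS
  obtain ⟨δ, hδ, hball⟩ := Metric.nhds_basis_closedBall.mem_iff.1 hv
  rw [Real.closedBall_eq_Icc] at hball
  have hmem : ∀ z ∈ u, ∀ r ∈ Set.Icc (r₀ - δ) (r₀ + δ), (z, r) ∈ S :=
    fun z hz r hr => huv ⟨hz, hball hr⟩
  have hz₀ := mem_of_mem_nhds hu
  have hl : (z₀, r₀ - δ) ∈ S := hmem _ hz₀ _ ⟨le_rfl, by linarith⟩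
  have hr : (z₀, r₀ + δ) ∈ S := hmem _ hz₀ _ ⟨by linarith, le_rfl⟩
  have cont : ∀ r, (z₀, r) ∈ S → ContinuousAt (fun z => H (z, r)) z₀ := fun r h =>
    ContinuousAt.comp (f := fun z : X => (z, r)) (hc _ h) (by fun_prop)
  filter_upwards [hu, (cont _ hl).eventually_lt_const (hlt _ (by linarith) hl),
    (cont _ hr).eventually_const_lt (hgt _ (by linarith) hr)] with z hz h1 h2
  have hcont : ContinuousOn (fun r => H (z, r)) (Set.Icc (r₀ - δ) (r₀ + δ)) := fun r hr' =>
    (ContinuousAt.comp (f := fun r : ℝ => (z, r)) (hc _ (hmem z hz r hr'))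
      (by fun_prop)).continuousWithinAt
  obtain ⟨r, hrI, hH⟩ := intermediate_value_Icc (by linarith) hcont ⟨h1.le, h2.le⟩
  exact ⟨r, hmem z hz r hrI, hH⟩

/-- All but the last coordinate of a vector. -/
def headVec {n : ℕ} (y : EuclideanSpace ℝ (Fin (n + 1))) : EuclideanSpace ℝ (Fin n) :=
  WithLp.toLp 2 fun j => y j.castSucc

/-- The vector with the given initial coordinates and last coordinate. -/
def snocVec {n : ℕ} (x : EuclideanSpace ℝ (Fin n)) (q : ℝ) : EuclideanSpace ℝ (Fin (n + 1)) :=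
  WithLp.toLp 2 (Fin.snoc (α := fun _ => ℝ) x.ofLp q)

lemma norm_sq_eq_headVec {n : ℕ} (y : EuclideanSpace ℝ (Fin (n + 1))) :
    ‖y‖ ^ 2 = ‖headVec y‖ ^ 2 + y (Fin.last n) ^ 2 := by
  simp [EuclideanSpace.real_norm_sq_eq, headVec, Fin.sum_univ_castSucc]

@[simp] lemma headVec_snocVec {n : ℕ} (x : EuclideanSpace ℝ (Fin n)) (q : ℝ) :
    headVec (snocVec x q) = x := by
  ext j; simp [headVec, snocVec]

@[simp] lemma snocVec_last {n : ℕ} (x : EuclideanSpace ℝ (Fin n)) (q : ℝ) :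
    snocVec x q (Fin.last n) = q := by
  simp [snocVec]

lemma snocVec_headVec {n : ℕ} (y : EuclideanSpace ℝ (Fin (n + 1))) :
    snocVec (headVec y) (y (Fin.last n)) = y := by
  ext j
  refine Fin.lastCases ?_ (fun j => ?_) j <;> simp [headVec, snocVec]

lemma norm_snocVec_sq {n : ℕ} (x : EuclideanSpace ℝ (Fin n)) (q : ℝ) :
    ‖snocVec x q‖ ^ 2 = ‖x‖ ^ 2 + q ^ 2 := by
  rw [norm_sq_eq_headVec]; simp

lemma ContinuousAt.snocVec {X : Type*} [TopologicalSpace X] {n : ℕ}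
    {f : X → EuclideanSpace ℝ (Fin n)} {g : X → ℝ} {x : X}
    (hf : ContinuousAt f x) (hg : ContinuousAt g x) :
    ContinuousAt (fun a => snocVec (f a) (g a)) x := by
  unfold _root_.snocVec
  have h : ContinuousAt (fun a => Fin.snoc (α := fun _ => ℝ) (f a).ofLp (g a)) x :=
    ContinuousAt.finSnoc (by fun_prop) hg
  fun_prop

section

variable {k : ℕ} {m : Fin k → ℕ}

/-- The product of unit spheres. -/
abbrev SphereProd (k : ℕ) (m : Fin k → ℕ) : Type :=
  ∀ i : Fin k, {y : EuclideanSpace ℝ (Fin (m i + 1)) // ‖y‖ = 1}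

/-- The last coordinate of the `i`-th factor. -/
def lastCoord (a : SphereProd k m) (i : Fin k) : ℝ := (a i).1 (Fin.last (m i))

lemma continuous_lastCoord (i : Fin k) : Continuous fun a : SphereProd k m => lastCoord a i := by
  unfold lastCoord; fun_prop

lemma rVec_fst (a : SphereProd k m) (i : Fin k) : (rVec k m a).fst i = headVec (a i).1 := rfl

lemma rVec_snd (a : SphereProd k m) : (rVec k m a).snd = ∏ i, lastCoord a i := rfl

lemma norm_headVec_sq_add (a : SphereProd k m) (i : Fin k) :
    ‖headVec (a i).1‖ ^ 2 + lastCoord a i ^ 2 = 1 := by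
  have := norm_sq_eq_headVec (a i).1
  rw [(a i).2] at this
  simpa [lastCoord] using this.symm

lemma continuous_rVec : Continuous (rVec k m) := by
  unfold rVec
  simp only [WithLp.equiv_symm_apply]
  fun_prop

lemma rVec_ne_zero (a : SphereProd k m) : rVec k m a ≠ 0 := by
  intro h
  have hq : ∀ i, lastCoord a i ≠ 0 := fun i hi => by
    have h1 := norm_headVec_sq_add a i
    rw [← rVec_fst, h, hi] at h1
    simp at h1
  have := rVec_snd a
  rw [h] at this
  exact Finset.prod_ne_zero_iff.2 (fun i _ => hq i) this.symm

lemma norm_rVec_pos (a : SphereProd k m) : 0 < ‖rVec k m a‖ := norm_pos_iff.2 (rVec_ne_zero a)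

/-- The normalized product map with values in the unit sphere. -/
def sphereMap (k : ℕ) (m : Fin k → ℕ) (a : SphereProd k m) :
    Metric.sphere (0 : RTarget k m) 1 :=
  ⟨rProj k m a, by
    rw [mem_sphere_zero_iff_norm, rProj, norm_smul, norm_inv, norm_norm,
      inv_mul_cancel₀ (norm_rVec_pos a).ne']⟩

lemma continuous_sphereMap : Continuous (sphereMap k m) :=
  Continuous.subtype_mk (Continuous.smul (M := ℝ) (X := RTarget k m)
    (continuous_rVec.norm.inv₀ fun a => (norm_rVec_pos a).ne') continuous_rVec) _

lemma norm_smul_sphereMap (a : SphereProd k m) :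
    ‖rVec k m a‖ • (sphereMap k m a).1 = rVec k m a :=
  smul_inv_smul₀ (norm_rVec_pos a).ne' _

lemma sphereMap_eq_of_rVec_eq {a : SphereProd k m} {z : Metric.sphere (0 : RTarget k m) 1} {r : ℝ}
    (hr : 0 < r) (h : rVec k m a = r • z.1) : sphereMap k m a = z := by
  apply Subtype.ext
  have hz : ‖z.1‖ = 1 := mem_sphere_zero_iff_norm.1 z.2
  change rProj k m a = z.1
  rw [rProj, h, norm_smul, hz, Real.norm_of_nonneg hr.le, mul_one, inv_smul_smul₀ hr.ne']

lemma norm_rVec_le_of_sphereMap_eq {i₀ : Fin k} {a b : SphereProd k m}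
    (ha₀ : ∀ i ≠ i₀, lastCoord a i ≠ 0) (h : sphereMap k m a = sphereMap k m b) :
    ‖rVec k m b‖ ≤ ‖rVec k m a‖ := by
  by_contra! hlt
  have ha := norm_smul_sphereMap a
  have hb' := norm_smul_sphereMap b
  rw [h] at ha
  set z := (sphereMap k m b).1
  set R := ‖rVec k m a‖
  set R' := ‖rVec k m b‖
  have hR : 0 < R := norm_rVec_pos a
  have hheada : ∀ i, ‖headVec (a i).1‖ = R * ‖z.fst i‖ := fun i => by
    rw [← rVec_fst, ← ha]; simp [norm_smul, abs_of_pos hR]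
  have hheadb : ∀ i, ‖headVec (b i).1‖ = R' * ‖z.fst i‖ := fun i => by
    rw [← rVec_fst, ← hb']; simp [norm_smul, abs_of_pos (hR.trans hlt)]
  have hsq : ∀ i, lastCoord b i ^ 2 ≤ lastCoord a i ^ 2 := fun i => by
    have h1 := norm_headVec_sq_add a i
    have h2 := norm_headVec_sq_add b i
    have h3 : ‖headVec (a i).1‖ ^ 2 ≤ ‖headVec (b i).1‖ ^ 2 := by
      rw [hheada, hheadb]; gcongr
    linarith
  have hpa : ∏ i, lastCoord a i = R * z.snd := by rw [← rVec_snd, ← ha]; simp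
  have hpb : ∏ i, lastCoord b i = R' * z.snd := by rw [← rVec_snd, ← hb']; simp
  have hprod : ∏ i, lastCoord b i ^ 2 ≤ ∏ i, lastCoord a i ^ 2 :=
    Finset.prod_le_prod (fun i _ => sq_nonneg _) fun i _ => hsq i
  rw [Finset.prod_pow, Finset.prod_pow, hpa, hpb, mul_pow, mul_pow] at hprod
  have hRR : R ^ 2 < R' ^ 2 := by gcongr
  have ht : z.snd = 0 := by
    by_contra ht
    have : 0 < z.snd ^ 2 := by positivity
    nlinarith
  have ha0 : lastCoord a i₀ = 0 := by
    rw [ht, mul_zero, Finset.prod_eq_zero_iff] at hpa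
    obtain ⟨i, -, hi⟩ := hpa
    by_cases hii : i = i₀
    · exact hii ▸ hi
    · exact absurd hi (ha₀ i hii)
  have h1 := norm_headVec_sq_add a i₀
  have h2 := norm_headVec_sq_add b i₀
  rw [hheada, ha0] at h1
  rw [hheadb] at h2
  have : 0 < ‖z.fst i₀‖ ^ 2 := by
    by_contra! hneg
    nlinarith [sq_nonneg R]
  have hlt' := mul_lt_mul_of_pos_right hRR this
  nlinarith [sq_nonneg (lastCoord b i₀)]

lemma eq_of_sphereMap_eq {i₀ : Fin k} {a b : SphereProd k m}
    (hab : ∀ i ≠ i₀, 0 < lastCoord a i * lastCoord b i)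
    (h : sphereMap k m a = sphereMap k m b) : a = b := by
  have ha : ∀ i ≠ i₀, lastCoord a i ≠ 0 := fun i hi h0 => by simpa [h0] using hab i hi
  have hb : ∀ i ≠ i₀, lastCoord b i ≠ 0 := fun i hi h0 => by simpa [h0] using hab i hi
  have hR := le_antisymm (norm_rVec_le_of_sphereMap_eq hb h.symm)
    (norm_rVec_le_of_sphereMap_eq ha h)
  have hv : rVec k m a = rVec k m b := by
    rw [← norm_smul_sphereMap a, ← norm_smul_sphereMap b, h, hR]
  have hhead : ∀ i, headVec (a i).1 = headVec (b i).1 := fun i => by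
    rw [← rVec_fst, ← rVec_fst, hv]
  have hlast : ∀ i ≠ i₀, lastCoord a i = lastCoord b i := fun i hi => by
    have h1 := norm_headVec_sq_add a i
    have h2 := norm_headVec_sq_add b i
    rw [hhead] at h1
    rcases sq_eq_sq_iff_eq_or_eq_neg.1 (show lastCoord a i ^ 2 = lastCoord b i ^ 2 by linarith)
      with h3 | h3
    · exact h3
    · have := hab i hi
      rw [h3] at this
      nlinarith [sq_nonneg (lastCoord b i)]
  have hlast₀ : lastCoord a i₀ = lastCoord b i₀ := by
    have hp : ∏ i, lastCoord a i = ∏ i, lastCoord b i := by rw [← rVec_snd, ← rVec_snd, hv]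
    rw [← Finset.mul_prod_erase _ _ (Finset.mem_univ i₀),
      ← Finset.mul_prod_erase _ (lastCoord b) (Finset.mem_univ i₀),
      Finset.prod_congr rfl fun i hi => hlast i (Finset.ne_of_mem_erase hi)] at hp
    exact mul_right_cancel₀
      (Finset.prod_ne_zero_iff.2 fun i hi => hb i (Finset.ne_of_mem_erase hi)) hp
  funext i
  apply Subtype.ext
  rw [← snocVec_headVec (a i).1, ← snocVec_headVec (b i).1, hhead]
  congr 1
  by_cases hi : i = i₀
  · exact hi ▸ hlast₀
  · exact hlast i hi

/-- The last coordinates of the points of the spheres, with signs `ε`, whose image has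
direction `w.1` and norm `w.2`; the coordinate `i₀` is recovered from the product. -/
def liftCoord (i₀ : Fin k) (ε : Fin k → ℝ) (w : RTarget k m × ℝ) (i : Fin k) : ℝ :=
  if i = i₀ then
    w.2 * w.1.snd / ∏ j ∈ univ.erase i₀, ε j * √(1 - w.2 ^ 2 * ‖w.1.fst j‖ ^ 2)
  else ε i * √(1 - w.2 ^ 2 * ‖w.1.fst i‖ ^ 2)

/-- The vectors of the factors whose image has direction `w.1` and norm `w.2`. -/
def liftVec (i₀ : Fin k) (ε : Fin k → ℝ) (w : RTarget k m × ℝ) (i : Fin k) :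
    EuclideanSpace ℝ (Fin (m i + 1)) :=
  snocVec (w.2 • w.1.fst i) (liftCoord i₀ ε w i)

/-- The pairs of a vector and a positive radius for which the heads of the factors
other than `i₀` lie in the open unit ball. -/
def liftDomain (m : Fin k → ℕ) (i₀ : Fin k) : Set (RTarget k m × ℝ) :=
  {w | 0 < w.2 ∧ ∀ i ≠ i₀, 0 < 1 - w.2 ^ 2 * ‖w.1.fst i‖ ^ 2}

lemma isOpen_liftDomain (i₀ : Fin k) : IsOpen (liftDomain m i₀) := by
  simp only [liftDomain, Set.ofPred_and, Set.ofPred_forall]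
  refine (isOpen_lt continuous_const continuous_snd).inter
    (isOpen_iInter_of_finite fun i => isOpen_iInter_of_finite fun _ =>
      isOpen_lt continuous_const ?_)
  fun_prop

lemma prod_sign_sqrt_ne_zero {i₀ : Fin k} {ε : Fin k → ℝ} (hε : ∀ i, ε i ^ 2 = 1)
    {w : RTarget k m × ℝ} (hw : w ∈ liftDomain m i₀) :
    ∏ j ∈ univ.erase i₀, ε j * √(1 - w.2 ^ 2 * ‖w.1.fst j‖ ^ 2) ≠ 0 := by
  refine Finset.prod_ne_zero_iff.2 fun j hj => mul_ne_zero (fun h => ?_)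
    (Real.sqrt_pos.2 (hw.2 j (Finset.ne_of_mem_erase hj))).ne'
  simpa [h] using hε j

lemma continuousAt_liftCoord {i₀ : Fin k} {ε : Fin k → ℝ} (hε : ∀ i, ε i ^ 2 = 1)
    {w : RTarget k m × ℝ} (hw : w ∈ liftDomain m i₀) (i : Fin k) :
    ContinuousAt (fun w => liftCoord i₀ ε w i) w := by
  unfold liftCoord
  split_ifs
  · refine ContinuousAt.div ?_ ?_ (prod_sign_sqrt_ne_zero hε hw)
    · fun_prop
    · fun_prop
  · fun_prop

lemma continuousAt_liftVec {i₀ : Fin k} {ε : Fin k → ℝ} (hε : ∀ i, ε i ^ 2 = 1)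
    {w : RTarget k m × ℝ} (hw : w ∈ liftDomain m i₀) (i : Fin k) :
    ContinuousAt (fun w => liftVec i₀ ε w i) w :=
  ContinuousAt.snocVec (by fun_prop) (continuousAt_liftCoord hε hw i)

lemma prod_liftCoord {i₀ : Fin k} {ε : Fin k → ℝ} (hε : ∀ i, ε i ^ 2 = 1)
    {w : RTarget k m × ℝ} (hw : w ∈ liftDomain m i₀) :
    ∏ i, liftCoord i₀ ε w i = w.2 * w.1.snd := by
  rw [← Finset.mul_prod_erase _ _ (Finset.mem_univ i₀)]
  have : ∏ i ∈ univ.erase i₀, liftCoord i₀ ε w i =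
      ∏ j ∈ univ.erase i₀, ε j * √(1 - w.2 ^ 2 * ‖w.1.fst j‖ ^ 2) :=
    Finset.prod_congr rfl fun i hi => if_neg (Finset.ne_of_mem_erase hi)
  rw [this, liftCoord, if_pos rfl, div_mul_cancel₀ _ (prod_sign_sqrt_ne_zero hε hw)]

lemma norm_liftVec_of_ne {i₀ : Fin k} {ε : Fin k → ℝ} (hε : ∀ i, ε i ^ 2 = 1)
    {w : RTarget k m × ℝ} (hw : w ∈ liftDomain m i₀) {i : Fin k} (hi : i ≠ i₀) :
    ‖liftVec i₀ ε w i‖ ^ 2 = 1 := by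
  rw [liftVec, norm_snocVec_sq, liftCoord, if_neg hi, mul_pow, hε, Real.sq_sqrt (hw.2 i hi).le,
    norm_smul, mul_pow, Real.norm_eq_abs, sq_abs]
  ring

lemma norm_liftVec_self {i₀ : Fin k} {ε : Fin k → ℝ} (hε : ∀ i, ε i ^ 2 = 1)
    {w : RTarget k m × ℝ} (hw : w ∈ liftDomain m i₀) :
    ‖liftVec i₀ ε w i₀‖ ^ 2 = w.2 ^ 2 * (‖w.1.fst i₀‖ ^ 2 +
      w.1.snd ^ 2 / ∏ j ∈ univ.erase i₀, (1 - w.2 ^ 2 * ‖w.1.fst j‖ ^ 2)) := by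
  have : (∏ j ∈ univ.erase i₀, ε j * √(1 - w.2 ^ 2 * ‖w.1.fst j‖ ^ 2)) ^ 2 =
      ∏ j ∈ univ.erase i₀, (1 - w.2 ^ 2 * ‖w.1.fst j‖ ^ 2) := by
    rw [← Finset.prod_pow]
    refine Finset.prod_congr rfl fun j hj => ?_
    rw [mul_pow, hε, Real.sq_sqrt (hw.2 j (Finset.ne_of_mem_erase hj)).le, one_mul]
  rw [liftVec, norm_snocVec_sq, liftCoord, if_pos rfl, div_pow, this,
    norm_smul, mul_pow, Real.norm_eq_abs, sq_abs]
  ring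

lemma norm_liftVec_self_strictMono {i₀ : Fin k} {ε : Fin k → ℝ} (hε : ∀ i, ε i ^ 2 = 1)
    {z : RTarget k m} {r s : ℝ} (hr : (z, r) ∈ liftDomain m i₀) (hs : (z, s) ∈ liftDomain m i₀)
    (hrs : r < s) (hpos : 0 < ‖liftVec i₀ ε (z, r) i₀‖ ^ 2 ∨ 0 < ‖liftVec i₀ ε (z, s) i₀‖ ^ 2) :
    ‖liftVec i₀ ε (z, r) i₀‖ ^ 2 < ‖liftVec i₀ ε (z, s) i₀‖ ^ 2 := by
  rw [norm_liftVec_self hε hr, norm_liftVec_self hε hs] at *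
  have hr0 : 0 < r := hr.1
  have hPs : 0 < ∏ j ∈ univ.erase i₀, (1 - s ^ 2 * ‖z.fst j‖ ^ 2) :=
    Finset.prod_pos fun j hj => hs.2 j (Finset.ne_of_mem_erase hj)
  have hPr : 0 < ∏ j ∈ univ.erase i₀, (1 - r ^ 2 * ‖z.fst j‖ ^ 2) :=
    Finset.prod_pos fun j hj => hr.2 j (Finset.ne_of_mem_erase hj)
  have hP : ∏ j ∈ univ.erase i₀, (1 - s ^ 2 * ‖z.fst j‖ ^ 2) ≤
      ∏ j ∈ univ.erase i₀, (1 - r ^ 2 * ‖z.fst j‖ ^ 2) :=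
    Finset.prod_le_prod (fun j hj => (hs.2 j (Finset.ne_of_mem_erase hj)).le) fun j _ => by
      gcongr
  have hK : ‖z.fst i₀‖ ^ 2 + z.snd ^ 2 / ∏ j ∈ univ.erase i₀, (1 - r ^ 2 * ‖z.fst j‖ ^ 2) ≤
      ‖z.fst i₀‖ ^ 2 + z.snd ^ 2 / ∏ j ∈ univ.erase i₀, (1 - s ^ 2 * ‖z.fst j‖ ^ 2) := by
    gcongr
  have h2 : r ^ 2 < s ^ 2 := by gcongr
  have hr2 : 0 < r ^ 2 := by positivity
  dsimp only at hpos ⊢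
  have hKs : 0 < ‖z.fst i₀‖ ^ 2 + z.snd ^ 2 / ∏ j ∈ univ.erase i₀, (1 - s ^ 2 * ‖z.fst j‖ ^ 2) := by
    rcases hpos with h | h
    · exact (pos_of_mul_pos_right h hr2.le).trans_le hK
    · exact pos_of_mul_pos_right h (hr2.trans h2).le
  exact (mul_le_mul_of_nonneg_left hK hr2.le).trans_lt (mul_lt_mul_of_pos_right h2 hKs)

lemma smul_sphereMap_fst (a : SphereProd k m) (i : Fin k) :
    ‖rVec k m a‖ • (sphereMap k m a).1.fst i = headVec (a i).1 :=
  congrArg (fun v : RTarget k m => v.fst i) (norm_smul_sphereMap a)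

lemma one_sub_norm_sq_eq (a : SphereProd k m) (i : Fin k) :
    1 - ‖rVec k m a‖ ^ 2 * ‖(sphereMap k m a).1.fst i‖ ^ 2 = lastCoord a i ^ 2 := by
  have h := norm_headVec_sq_add a i
  rw [← smul_sphereMap_fst, norm_smul, mul_pow, norm_norm] at h
  linarith

lemma mem_liftDomain {i₀ : Fin k} {a : SphereProd k m} (ha : ∀ i ≠ i₀, lastCoord a i ≠ 0) :
    ((sphereMap k m a).1, ‖rVec k m a‖) ∈ liftDomain m i₀ := by
  refine ⟨norm_rVec_pos a, fun i hi => ?_⟩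
  have := ha i hi
  rw [one_sub_norm_sq_eq]
  positivity

lemma liftVec_sphereMap {i₀ : Fin k} {a : SphereProd k m} (ha : ∀ i ≠ i₀, lastCoord a i ≠ 0)
    {ε : Fin k → ℝ} (hε : ∀ i, ε i * |lastCoord a i| = lastCoord a i) (i : Fin k) :
    liftVec i₀ ε ((sphereMap k m a).1, ‖rVec k m a‖) i = (a i).1 := by
  have hq : ∀ j, ε j * √(1 - ‖rVec k m a‖ ^ 2 * ‖(sphereMap k m a).1.fst j‖ ^ 2) =
      lastCoord a j := fun j => by
    rw [one_sub_norm_sq_eq, Real.sqrt_sq_eq_abs, hε]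
  have hc : liftCoord i₀ ε ((sphereMap k m a).1, ‖rVec k m a‖) i = lastCoord a i := by
    unfold liftCoord
    split_ifs with h
    · simp only [hq]
      subst h
      rw [div_eq_iff (Finset.prod_ne_zero_iff.2 fun j hj => ha j (Finset.ne_of_mem_erase hj)),
        Finset.mul_prod_erase _ _ (Finset.mem_univ i), ← rVec_snd]
      conv_rhs => rw [← norm_smul_sphereMap a]
      simp
    · exact hq i
  rw [liftVec, hc, smul_sphereMap_fst]
  exact snocVec_headVec _

lemma sphereMap_image_mem_nhds {i₀ : Fin k} {a : SphereProd k m}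
    (ha : ∀ i ≠ i₀, lastCoord a i ≠ 0) {N : Set (SphereProd k m)} (hN : N ∈ 𝓝 a) :
    sphereMap k m '' N ∈ 𝓝 (sphereMap k m a) := by
  have hsign : ∀ x : ℝ, ∃ e : ℝ, e ^ 2 = 1 ∧ e * |x| = x := fun x => by
    rcases abs_choice x with h | h
    · exact ⟨1, by simp, by simp [h]⟩
    · exact ⟨-1, by simp, by simp [h]⟩
  choose ε hε hεa using fun i => hsign (lastCoord a i)
  set w₀ : RTarget k m × ℝ := ((sphereMap k m a).1, ‖rVec k m a‖)
  have hw : w₀ ∈ liftDomain m i₀ := mem_liftDomain ha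
  have hlift : liftVec i₀ ε w₀ = fun i => (a i).1 := funext (liftVec_sphereMap ha hεa)
  have hind : IsInducing fun (b : SphereProd k m) i => (b i).1 :=
    Topology.IsInducing.piMap fun _ => IsInducing.subtypeVal
  rw [hind.nhds_eq_comap] at hN
  obtain ⟨N', hN', hNN'⟩ := hN
  have hS : liftDomain m i₀ ∩ liftVec i₀ ε ⁻¹' N' ∈ 𝓝 w₀ := by
    refine inter_mem ((isOpen_liftDomain i₀).mem_nhds hw) ?_
    have : ContinuousAt (liftVec i₀ ε) w₀ := continuousAt_pi.2 (continuousAt_liftVec hε hw)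
    exact this (by rwa [hlift])
  have h1 : ‖liftVec i₀ ε w₀ i₀‖ ^ 2 = 1 := by rw [hlift, (a i₀).2, one_pow]
  have key := eventually_exists_eq_of_crossing (H := fun w => ‖liftVec i₀ ε w i₀‖ ^ 2) (c := 1) hS
    (fun w hw => (continuousAt_liftVec hε hw.1 i₀).norm.pow 2)
    (fun r hr hrS => (norm_liftVec_self_strictMono hε hrS.1 hw hr
      (Or.inr (h1.symm ▸ one_pos))).trans_eq h1)
    (fun r hr hrS => h1.symm.trans_lt (norm_liftVec_self_strictMono hε hw hrS.1 hr
      (Or.inl (h1.symm ▸ one_pos))))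
  filter_upwards [continuous_subtype_val.continuousAt.eventually key] with z ⟨r, hrS, hr⟩
  have hnorm : ∀ i, ‖liftVec i₀ ε (z.1, r) i‖ = 1 := fun i => by
    rw [← sq_eq_sq₀ (norm_nonneg _) zero_le_one, one_pow]
    by_cases hi : i = i₀
    · subst hi; exact hr
    · exact norm_liftVec_of_ne hε hrS.1 hi
  refine ⟨fun i => ⟨liftVec i₀ ε (z.1, r) i, hnorm i⟩, hNN' hrS.2,
    sphereMap_eq_of_rVec_eq hrS.1.1 ?_⟩
  refine WithLp.ofLp_injective 2 (Prod.ext (PiLp.ext fun i => ?_) ?_)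
  · exact headVec_snocVec _ _
  · exact (Finset.prod_congr rfl fun i _ => snocVec_last (r • z.1.fst i) _).trans
      (prod_liftCoord hε hrS.1)

lemma isLocalHomeomorphOn_sphereMap (i₀ : Fin k) :
    IsLocalHomeomorphOn (sphereMap k m) {a | ∀ i ≠ i₀, lastCoord a i ≠ 0} := by
  refine (isLocalHomeomorphOn_iff_isOpenEmbedding_restrict _).2 fun a ha => ?_
  set U : Set (SphereProd k m) := {b | ∀ i ≠ i₀, 0 < lastCoord a i * lastCoord b i}
  have hU : IsOpen U := by
    simp only [U, Set.ofPred_forall]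
    exact isOpen_iInter_of_finite fun i => isOpen_iInter_of_finite fun _ =>
      isOpen_lt continuous_const (continuous_const.mul (continuous_lastCoord i))
  refine ⟨U, hU.mem_nhds fun i hi => mul_self_pos.2 (ha i hi),
    .of_continuous_injective_isOpenMap (continuous_sphereMap.comp continuous_subtype_val) ?_ ?_⟩
  · rintro ⟨b, hb⟩ ⟨c, hc⟩ hbc
    refine Subtype.ext (eq_of_sphereMap_eq (i₀ := i₀) (fun i hi => ?_) hbc)
    have h := mul_pos (hb i hi) (hc i hi)
    have h' : 0 < lastCoord a i ^ 2 := sq_pos_of_ne_zero (ha i hi)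
    refine pos_of_mul_pos_right (a := lastCoord a i ^ 2) ?_ h'.le
    convert h using 1
    ring
  · refine isOpenMap_iff_nhds_le.2 fun b => ?_
    have hb : ∀ i ≠ i₀, lastCoord b.1 i ≠ 0 := fun i hi h0 => by simpa [h0] using b.2 i hi
    have : Filter.map (U.domRestrict (sphereMap k m)) (𝓝 b) =
        Filter.map (sphereMap k m) (𝓝 b.1) := by
      rw [← hU.isOpenEmbedding_subtypeVal.map_nhds_eq, Filter.map_map]
      rfl
    rw [this]
    exact Filter.le_map fun N hN => sphereMap_image_mem_nhds hb hN

end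

/-- the map `p : S^{m₁} × ⋯ × S^{m_k} → S^m` given by the normalized vector
`(x_{1,1},…,x_{m_k,k}, q₁⋯q_k)/|⋯|` is a local homeomorphism at every point at which at most
one of the last coordinates `q₁, …, q_k` vanishes. -/
theorem stmt18 (k : ℕ) (hk : 2 ≤ k) (m : Fin k → ℕ) (hm : ∀ i, 1 ≤ m i) :
    ∃ p : (∀ i : Fin k, {y : EuclideanSpace ℝ (Fin (m i + 1)) // ‖y‖ = 1}) →
        Metric.sphere (0 : RTarget k m) 1,
      (∀ a, (p a).1 = rProj k m a) ∧
      IsLocalHomeomorphOn p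
        {a | Set.Subsingleton {i : Fin k | (a i).1 (Fin.last (m i)) = 0}} := by
  refine ⟨sphereMap k m, fun _ => rfl, fun a ha => ?_⟩
  obtain ⟨i₀, hi₀⟩ : ∃ i₀ : Fin k, ∀ i ≠ i₀, lastCoord a i ≠ 0 := by
    by_cases h : ∃ i, lastCoord a i = 0
    · obtain ⟨i₀, h₀⟩ := h
      exact ⟨i₀, fun i hi h => hi (ha h h₀)⟩
    · push Not at h
      exact ⟨⟨0, by lia⟩, fun i _ => h i⟩
  exact isLocalHomeomorphOn_sphereMap i₀ a hi₀
end
end
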